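/- arXiv:2212.00610 — 6 statements merged into one kernel-verified Lean document; each statement's English description precedes it below -/
import Mathlib

section
/- For every n ≥ 3, the 5-tone chromatic number of the cycle C_n satisfies: τ₅(C_n) = 20 if n = 5; τ₅(C_n) = 18 if n ∈ {4,6}; τ₅(C_n) = 17 if n ∈ {7,9}; τ₅(C_n) = 15 if n = 3; and τ₅(C_n) = 16 otherwise. -/
open SimpleGraph

/-- A `t`-tone `k`-coloring of a graph `G` assigns to each vertex a `t`-element subset of
`{1, …, k}` so that the labels of any two distinct vertices `v, w` share fewer than
`d(v,w)` colors (no constraint between different components, where the distance is infinite). -/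
def IsTToneColoring {V : Type*} (G : SimpleGraph V) (t k : ℕ) (f : V → Finset ℕ) : Prop :=
  (∀ v, f v ⊆ Finset.Icc 1 k) ∧ (∀ v, (f v).card = t) ∧
    ∀ ⦃v w : V⦄, v ≠ w → ((f v ∩ f w).card : ℕ∞) < G.edist v w

/-- The `t`-tone chromatic number: the least `k` admitting a `t`-tone `k`-coloring. -/
noncomputable def toneChromaticNumber {V : Type*} (G : SimpleGraph V) (t : ℕ) : ℕ :=
  sInf {k | ∃ f : V → Finset ℕ, IsTToneColoring G t k f}

/-! ### Distances in cycles -/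

lemma edist_cycleGraph_add_mod_le {n : ℕ} (hn : 2 ≤ n) (i : Fin n) (m : ℕ) :
    (cycleGraph n).edist i ⟨(i + m) % n, Nat.mod_lt _ (by omega)⟩ ≤ m := by
  induction m with
  | zero => simp [Nat.mod_eq_of_lt i.isLt]
  | succ m ih =>
    refine (SimpleGraph.edist_triangle (v := ⟨(i + m) % n, Nat.mod_lt _ (by omega)⟩)).trans ?_
    push_cast
    gcongr
    refine le_of_eq (SimpleGraph.edist_eq_one_iff_adj.2 (cycleGraph_adj'.2 (Or.inr ?_)))
    rw [Fin.val_sub]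
    have h : (i + (m + 1)) % n = ((i + m) % n + 1) % n := by rw [Nat.mod_add_mod, add_assoc]
    have hlt : (i + m : ℕ) % n < n := Nat.mod_lt _ (by omega)
    simp only [h]
    generalize (i + m : ℕ) % n = r at hlt
    rw [Nat.add_mod_mod, show n - r + (r + 1) = 1 + n by omega, Nat.add_mod_right,
      Nat.mod_eq_of_lt (by omega)]

lemma exists_modEq_of_walk_cycleGraph {n : ℕ} {v w : Fin n} (p : (cycleGraph n).Walk v w) :
    ∃ e : ℤ, |e| ≤ p.length ∧ (w : ℤ) ≡ v + e [ZMOD n] := by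
  induction p with
  | nil => exact ⟨0, by simp, by simp [Int.ModEq]⟩
  | @cons v u w h p ih =>
    obtain ⟨e, he, hw⟩ := ih
    have key : ∀ a b : Fin n, (a - b).val = 1 → (a : ℤ) ≡ b + 1 [ZMOD n] := by
      intro a b hab
      rw [Fin.val_sub] at hab
      have h1 : (((n - b + a : ℕ) : ℤ)) ≡ 1 [ZMOD n] := by
        have := Int.mod_modEq ((n - b + a : ℕ) : ℤ) n
        rw [← Int.natCast_mod, hab] at this
        exact_mod_cast this.symm
      rw [Nat.cast_add, Nat.cast_sub b.isLt.le] at h1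
      have h2 := (Int.modEq_iff_dvd.1 h1)
      refine Int.modEq_iff_dvd.2 ?_
      have h3 := dvd_add h2 (dvd_refl (n : ℤ))
      rwa [show (1 - (n - b + a) + n : ℤ) = b + 1 - a by ring] at h3
    rw [SimpleGraph.Walk.length_cons]
    push_cast
    have he' := abs_le.1 he
    rcases cycleGraph_adj'.1 h with h | h
    · refine ⟨e - 1, abs_le.2 ⟨by omega, by omega⟩, hw.trans ?_⟩
      have := ((key _ _ h).symm.add_right (e - 1))
      convert this using 1
      ring
    · refine ⟨e + 1, abs_le.2 ⟨by omega, by omega⟩, hw.trans ?_⟩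
      have := ((key _ _ h).add_right e)
      convert this using 1
      ring

/-- Vertices of `C_n` joined by a walk of length `l` are at most `l` steps apart along the cycle. -/
lemma exists_add_mod_eq_of_walk_cycleGraph {n : ℕ} {v w : Fin n}
    (p : (cycleGraph n).Walk v w) :
    ∃ e ≤ p.length, (v + e) % n = (w : ℕ) ∨ (w + e) % n = (v : ℕ) := by
  obtain ⟨e, he, hw⟩ := exists_modEq_of_walk_cycleGraph p
  rw [Int.abs_eq_natAbs] at he
  refine ⟨e.natAbs, by exact_mod_cast he, ?_⟩
  rcases Int.natAbs_eq e with h | h <;> rw [h] at hw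
  · left
    have h1 : (w : ℕ) ≡ v + e.natAbs [MOD n] := by
      rw [← Int.natCast_modEq_iff]
      exact_mod_cast hw
    rw [← h1, Nat.mod_eq_of_lt w.isLt]
  · right
    have h1 : (w : ℕ) + e.natAbs ≡ v [MOD n] := by
      rw [← Int.natCast_modEq_iff]
      have := hw.add_right (e.natAbs : ℤ)
      rw [neg_add_cancel_right] at this
      exact_mod_cast this
    rw [h1, Nat.mod_eq_of_lt v.isLt]

/-! ### Colorings from cyclic words -/

/-- The labels `g 0, …, g (n - 1)`, read cyclically, form a `5`-tone `k`-coloring of `C_n`. -/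
def IsCyclicTone (k n : ℕ) (g : ℕ → Finset ℕ) : Prop :=
  ∀ i < n, g i ⊆ Finset.Icc 1 k ∧ (g i).card = 5 ∧
    ∀ d < 5, (i + (d + 1)) % n ≠ i → (g i ∩ g ((i + (d + 1)) % n)).card ≤ d

instance (k n : ℕ) (g : ℕ → Finset ℕ) : Decidable (IsCyclicTone k n g) :=
  inferInstanceAs (Decidable (∀ i < n, g i ⊆ Finset.Icc 1 k ∧ (g i).card = 5 ∧
    ∀ d < 5, (i + (d + 1)) % n ≠ i → (g i ∩ g ((i + (d + 1)) % n)).card ≤ d))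

lemma IsCyclicTone.isTToneColoring {k n : ℕ} {g : ℕ → Finset ℕ} (hg : IsCyclicTone k n g) :
    IsTToneColoring (cycleGraph n) 5 k (fun i => g i) := by
  refine ⟨fun v => (hg v v.isLt).1, fun v => (hg v v.isLt).2.1, fun v w hvw => ?_⟩
  have hne : (v : ℕ) ≠ w := fun h => hvw (Fin.ext h)
  have hv5 : (g v ∩ g w).card ≤ 5 :=
    (Finset.card_le_card Finset.inter_subset_left).trans (hg v v.isLt).2.1.le
  refine lt_of_not_ge fun hle => ?_
  have hfin : (cycleGraph n).edist v w ≠ ⊤ := fun h => by simp [h] at hle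
  obtain ⟨p, hp⟩ := SimpleGraph.exists_walk_of_edist_ne_top hfin
  rw [← hp] at hle
  have hle' : p.length ≤ (g v ∩ g w).card := by exact_mod_cast hle
  obtain ⟨e, he, h⟩ := exists_add_mod_eq_of_walk_cycleGraph p
  have step : ∀ a b : Fin n, a ≠ b → (a + e) % n = (b : ℕ) → (g a ∩ g b).card < e := by
    intro a b hab h
    have hab' : (b : ℕ) ≠ a := fun h => hab (Fin.ext h.symm)
    rcases e with _ | d
    · simp only [add_zero, Nat.mod_eq_of_lt a.isLt] at h
      exact absurd h.symm hab'
    · have := (hg a a.isLt).2.2 d (by omega) (by rw [h]; exact hab')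
      rw [h] at this
      omega
  rcases h with h | h
  · have := step v w hvw h
    omega
  · have := step w v hvw.symm h
    rw [Finset.inter_comm] at this
    omega

/-- Cyclic words for the exceptional cycles. -/
def exceptionalWord : ℕ → List (Finset ℕ)
  | 3 => [{1, 2, 3, 4, 5},
    {6, 7, 8, 9, 10},
    {11, 12, 13, 14, 15}]
  | 4 => [{1, 2, 3, 4, 5},
    {6, 7, 8, 9, 10},
    {1, 11, 12, 13, 14},
    {6, 15, 16, 17, 18}]
  | 5 => [{1, 2, 3, 4, 5},
    {6, 7, 8, 9, 10},
    {1, 11, 12, 13, 14},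
    {2, 6, 15, 16, 17},
    {7, 11, 18, 19, 20}]
  | 6 => [{1, 2, 3, 4, 5},
    {6, 7, 8, 9, 10},
    {3, 11, 12, 13, 14},
    {2, 4, 10, 15, 16},
    {5, 8, 9, 13, 17},
    {7, 11, 14, 15, 18}]
  | 7 => [{1, 2, 3, 4, 5},
    {6, 7, 8, 9, 10},
    {1, 11, 12, 13, 14},
    {2, 3, 6, 15, 16},
    {1, 4, 7, 8, 17},
    {2, 9, 10, 11, 12},
    {6, 13, 14, 15, 17}]
  | 9 => [{1, 2, 3, 4, 5},
    {6, 7, 8, 9, 10},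
    {3, 11, 12, 13, 15},
    {4, 5, 7, 16, 17},
    {2, 8, 9, 14, 15},
    {1, 3, 4, 10, 12},
    {5, 6, 7, 11, 15},
    {2, 8, 10, 13, 17},
    {9, 11, 12, 14, 16}]
  | _ => []

/-- Cyclic words with colors `1, …, 16` that share their first five labels. -/
def block : ℕ → List (Finset ℕ)
  | 8 => [{1, 2, 3, 4, 5},
    {6, 7, 8, 9, 10},
    {1, 11, 12, 13, 14},
    {2, 3, 10, 15, 16},
    {4, 5, 8, 9, 11},
    {1, 2, 6, 7, 12},
    {3, 8, 10, 13, 14},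
    {9, 11, 12, 15, 16}]
  | 10 => [{1, 2, 3, 4, 5},
    {6, 7, 8, 9, 10},
    {1, 11, 12, 13, 14},
    {2, 3, 10, 15, 16},
    {4, 5, 8, 9, 11},
    {6, 7, 12, 13, 15},
    {1, 4, 10, 14, 16},
    {2, 3, 8, 9, 12},
    {5, 7, 10, 11, 13},
    {6, 12, 14, 15, 16}]
  | 11 => [{1, 2, 3, 4, 5},
    {6, 7, 8, 9, 10},
    {1, 11, 12, 13, 14},
    {2, 3, 10, 15, 16},
    {4, 5, 8, 9, 11},
    {1, 6, 7, 10, 14},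
    {9, 12, 13, 15, 16},
    {2, 3, 5, 6, 11},
    {1, 4, 7, 8, 16},
    {5, 9, 10, 12, 14},
    {6, 11, 13, 15, 16}]
  | 12 => [{1, 2, 3, 4, 5},
    {6, 7, 8, 9, 10},
    {1, 11, 12, 13, 14},
    {2, 3, 10, 15, 16},
    {4, 5, 8, 9, 11},
    {1, 3, 6, 7, 12},
    {5, 10, 13, 14, 16},
    {1, 2, 8, 9, 15},
    {3, 4, 11, 12, 13},
    {1, 5, 6, 7, 16},
    {2, 9, 10, 11, 14},
    {8, 12, 13, 15, 16}]
  | 13 => [{1, 2, 3, 4, 5},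
    {6, 7, 8, 9, 10},
    {1, 11, 12, 13, 14},
    {2, 3, 10, 15, 16},
    {4, 5, 8, 9, 11},
    {2, 6, 7, 12, 14},
    {1, 11, 13, 15, 16},
    {3, 6, 8, 9, 10},
    {4, 5, 12, 13, 14},
    {2, 3, 7, 11, 16},
    {1, 4, 8, 9, 15},
    {5, 6, 10, 11, 12},
    {7, 13, 14, 15, 16}]
  | 14 => [{1, 2, 3, 4, 5},
    {6, 7, 8, 9, 10},
    {1, 11, 12, 13, 14},
    {2, 3, 10, 15, 16},
    {4, 5, 8, 9, 11},
    {1, 6, 7, 13, 15},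
    {9, 10, 12, 14, 16},
    {2, 3, 4, 5, 7},
    {1, 6, 8, 11, 12},
    {7, 10, 13, 14, 15},
    {3, 4, 9, 11, 16},
    {2, 5, 6, 8, 10},
    {1, 7, 9, 12, 14},
    {6, 11, 13, 15, 16}]
  | 15 => [{1, 2, 3, 4, 5},
    {6, 7, 8, 9, 10},
    {1, 11, 12, 13, 14},
    {2, 3, 10, 15, 16},
    {4, 5, 8, 9, 11},
    {1, 6, 7, 10, 14},
    {2, 3, 4, 12, 13},
    {8, 10, 11, 15, 16},
    {5, 6, 7, 9, 12},
    {1, 2, 3, 8, 14},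
    {4, 7, 13, 15, 16},
    {2, 5, 9, 10, 11},
    {1, 3, 6, 7, 12},
    {4, 8, 9, 13, 14},
    {10, 11, 12, 15, 16}]
  | 17 => [{1, 2, 3, 4, 5},
    {6, 7, 8, 9, 10},
    {1, 11, 12, 13, 14},
    {2, 3, 10, 15, 16},
    {4, 5, 8, 9, 11},
    {6, 7, 10, 12, 13},
    {1, 11, 14, 15, 16},
    {2, 3, 6, 8, 9},
    {1, 4, 5, 7, 10},
    {2, 11, 12, 13, 14},
    {1, 3, 6, 15, 16},
    {2, 4, 5, 8, 9},
    {1, 7, 10, 11, 12},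
    {2, 3, 13, 14, 16},
    {1, 5, 6, 8, 15},
    {4, 7, 9, 12, 13},
    {10, 11, 14, 15, 16}]
  | _ => []

/-- `q` copies of the block of length `8`, followed by the block of length `L`. -/
def blockWord (q L i : ℕ) : Finset ℕ :=
  if i < 8 * q then (block 8).getD (i % 8) ∅ else (block L).getD (i - 8 * q) ∅

lemma isCyclicTone_block : ∀ L ∈ [8, 10, 11, 12, 13, 14, 15, 17],
    IsCyclicTone 16 L (fun i => (block L).getD i ∅) := by
  decide +kernel

lemma block_getD_of_lt_five : ∀ L ∈ [8, 10, 11, 12, 13, 14, 15, 17], ∀ i < 5,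
    (block L).getD i ∅ = (block 8).getD i ∅ := by
  decide +kernel

lemma isCyclicTone_blockWord (q L : ℕ) (hL : L ∈ [8, 10, 11, 12, 13, 14, 15, 17]) :
    IsCyclicTone 16 (8 * q + L) (blockWord q L) := by
  have h8 : 8 ≤ L := by
    revert L
    decide
  intro i hi
  by_cases hq : i < 8 * q
  · obtain ⟨h1, h2, h3⟩ := isCyclicTone_block 8 (by simp) (i % 8) (Nat.mod_lt _ (by norm_num))
    have e1 : blockWord q L i = (block 8).getD (i % 8) ∅ := if_pos hq
    rw [e1]
    refine ⟨h1, h2, fun d hd hne => ?_⟩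
    have e2 : blockWord q L ((i + (d + 1)) % (8 * q + L))
        = (block 8).getD ((i % 8 + (d + 1)) % 8) ∅ := by
      rw [Nat.mod_eq_of_lt (by omega), Nat.mod_add_mod]
      unfold blockWord
      split_ifs with h
      · rfl
      · rw [block_getD_of_lt_five L hL _ (by omega)]
        congr 1
        omega
    rw [e2]
    exact h3 d hd (by omega)
  · obtain ⟨j, rfl⟩ : ∃ j, i = 8 * q + j := ⟨i - 8 * q, by omega⟩
    obtain ⟨h1, h2, h3⟩ := isCyclicTone_block L hL j (by omega)
    have e1 : ∀ j, blockWord q L (8 * q + j) = (block L).getD j ∅ := by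
      intro j
      simp [blockWord]
    rw [e1]
    refine ⟨h1, h2, fun d hd hne => ?_⟩
    have e2 : blockWord q L ((8 * q + j + (d + 1)) % (8 * q + L))
        = (block L).getD ((j + (d + 1)) % L) ∅ := by
      by_cases h : j + (d + 1) < L
      · rw [Nat.mod_eq_of_lt (by omega), Nat.mod_eq_of_lt h, add_assoc, e1]
      · obtain ⟨r, hr⟩ : ∃ r, j + (d + 1) = L + r := ⟨j + (d + 1) - L, by omega⟩
        rw [add_assoc, hr, ← add_assoc, Nat.add_mod_left, Nat.add_mod_left,
          Nat.mod_eq_of_lt (by omega), Nat.mod_eq_of_lt (by omega)]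
        by_cases hr' : r < 8 * q
        · rw [block_getD_of_lt_five L hL r (by omega), blockWord, if_pos hr', Nat.mod_eq_of_lt (by omega)]
        · obtain rfl : q = 0 := by omega
          simpa using e1 r
    rw [e2]
    refine h3 d hd ?_
    by_cases h : j + (d + 1) < L
    · rw [Nat.mod_eq_of_lt h]
      omega
    · rw [Nat.mod_eq_sub_mod (by omega), Nat.mod_eq_of_lt (by omega)]
      omega

lemma exists_isTToneColoring_sixteen (n : ℕ) (hn : n = 8 ∨ 10 ≤ n) :
    ∃ f, IsTToneColoring (cycleGraph n) 5 16 f := by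
  obtain ⟨q, L, hL, rfl⟩ :
      ∃ q L, L ∈ [8, 10, 11, 12, 13, 14, 15, 17] ∧ n = 8 * q + L := by
    by_cases h0 : n % 8 = 0
    · exact ⟨n / 8 - 1, 8, by simp, by omega⟩
    by_cases h1 : n % 8 = 1
    · exact ⟨n / 8 - 2, 17, by simp, by omega⟩
    · refine ⟨n / 8 - 1, n % 8 + 8, ?_, by omega⟩
      have : n % 8 < 8 := Nat.mod_lt _ (by norm_num)
      generalize n % 8 = r at *
      interval_cases r <;> simp_all
  exact ⟨_, (isCyclicTone_blockWord q L hL).isTToneColoring⟩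

lemma exists_isTToneColoring_of_exceptionalWord {n k : ℕ}
    (h : IsCyclicTone k n (fun i => (exceptionalWord n).getD i ∅)) :
    ∃ f, IsTToneColoring (cycleGraph n) 5 k f :=
  ⟨_, h.isTToneColoring⟩

/-! ### Lower bounds by weighted counting of color classes -/

/-- If every set of indices satisfies a weighted inequality, summing it over the color classes
bounds the number of colors. -/
lemma card_mul_le_of_forall_weight_le {ι : Type*} [Fintype ι] [DecidableEq ι] {k t a b : ℕ}
    (f : ι → Finset ℕ) (w : ι → ι → ℕ) (hsub : ∀ i, f i ⊆ Finset.Icc 1 k)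
    (hcard : ∀ i, (f i).card = t)
    (h : ∀ S : Finset ι, a * S.card ≤ b + ∑ i ∈ S, ∑ j ∈ S, w i j) :
    a * (Fintype.card ι * t) ≤ k * b + ∑ i, ∑ j, w i j * (f i ∩ f j).card := by
  have hc : ∀ s : Finset ℕ, s ⊆ Finset.Icc 1 k →
      s.card = ∑ c ∈ Finset.Icc 1 k, if c ∈ s then 1 else 0 := by
    intro s hs
    rw [Finset.sum_ite_mem, Finset.inter_eq_right.2 hs, Finset.card_eq_sum_ones]
  have hleft : ∑ c ∈ Finset.Icc 1 k, a * (Finset.univ.filter fun i => c ∈ f i).card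
      = a * (Fintype.card ι * t) := by
    rw [← Finset.mul_sum]
    congr 1
    simp_rw [Finset.card_filter]
    rw [Finset.sum_comm]
    simp_rw [← hc _ (hsub _), hcard]
    simp
  have hright : ∑ c ∈ Finset.Icc 1 k,
      (b + ∑ i ∈ Finset.univ.filter (fun i => c ∈ f i),
        ∑ j ∈ Finset.univ.filter (fun i => c ∈ f i), w i j)
      = k * b + ∑ i, ∑ j, w i j * (f i ∩ f j).card := by
    rw [Finset.sum_add_distrib]
    congr 1
    · simp
    simp_rw [Finset.sum_filter]
    rw [Finset.sum_comm]
    refine Finset.sum_congr rfl fun i _ => ?_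
    have : ∀ c, (if c ∈ f i then ∑ j, (if c ∈ f j then w i j else 0) else 0)
        = ∑ j, w i j * (if c ∈ f i ∩ f j then 1 else 0) := by
      intro c
      by_cases hi : c ∈ f i <;> simp [hi]
    simp_rw [this]
    rw [Finset.sum_comm]
    refine Finset.sum_congr rfl fun j _ => ?_
    rw [← Finset.mul_sum, ← hc _ (Finset.inter_subset_left.trans (hsub i))]
  rw [← hleft, ← hright]
  exact Finset.sum_le_sum fun c _ => h _

lemma IsTToneColoring.card_inter_lt_of_add_mod_eq {n t k : ℕ} {f : Fin n → Finset ℕ}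
    (hf : IsTToneColoring (cycleGraph n) t k f) {i j : Fin n} (hij : i ≠ j) {d : ℕ}
    (h : (i + d) % n = (j : ℕ)) : (f i ∩ f j).card < d := by
  have hn : 2 ≤ n := by
    have := i.isLt
    have := j.isLt
    have : (i : ℕ) ≠ j := fun h => hij (Fin.ext h)
    omega
  have h1 := edist_cycleGraph_add_mod_le hn i d
  simp only [h] at h1
  exact_mod_cast (hf.2.2 hij).trans_le h1

/-- The counting bound for a coloring of `C_n`, applied to its first `m` vertices; `d i j` is an
upper bound for the distance between the vertices `i` and `j`. -/
lemma IsTToneColoring.mul_le_of_forall_weight_le {n t k m a b : ℕ} {f : Fin n → Finset ℕ}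
    (hf : IsTToneColoring (cycleGraph n) t k f) (hm : m ≤ n) (w d : Fin m → Fin m → ℕ)
    (hd : ∀ i j, w i j ≠ 0 → i ≠ j ∧ (i + d i j) % n = (j : ℕ))
    (h : ∀ S : Finset (Fin m), a * S.card ≤ b + ∑ i ∈ S, ∑ j ∈ S, w i j) :
    a * (m * t) ≤ k * b + ∑ i, ∑ j, w i j * (d i j - 1) := by
  have h1 := card_mul_le_of_forall_weight_le (fun i => f (Fin.castLE hm i)) w
    (fun i => hf.1 _) (fun i => hf.2.1 _) h
  rw [Fintype.card_fin] at h1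
  refine h1.trans ?_
  refine Nat.add_le_add_left (Finset.sum_le_sum fun i _ => Finset.sum_le_sum fun j _ => ?_) _
  by_cases hw : w i j = 0
  · simp [hw]
  · obtain ⟨hne, he⟩ := hd i j hw
    have := hf.card_inter_lt_of_add_mod_eq (i := Fin.castLE hm i) (j := Fin.castLE hm j)
      (fun h => hne (Fin.castLE_injective hm h)) he
    exact Nat.mul_le_mul_left _ (by omega)

/-- Weights `10`, `x`, `y` for pairs of vertices of `C_n` that are `1`, `2`, `3` steps apart. -/
def stepWeight (n x y : ℕ) (i j : Fin n) : ℕ :=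
  match (j + (n - i)) % n with
  | 1 => 10
  | 2 => x
  | 3 => y
  | _ => 0

lemma IsTToneColoring.mul_le_of_forall_stepWeight_le {n t k a b : ℕ} {f : Fin n → Finset ℕ}
    (hf : IsTToneColoring (cycleGraph n) t k f) (x y : ℕ)
    (h : ∀ S : Finset (Fin n), a * S.card ≤ b + ∑ i ∈ S, ∑ j ∈ S, stepWeight n x y i j) :
    a * (n * t) ≤
      k * b + ∑ i : Fin n, ∑ j : Fin n, stepWeight n x y i j * ((j + (n - i)) % n - 1) := by
  refine hf.mul_le_of_forall_weight_le le_rfl _ _ (fun i j hw => ⟨?_, ?_⟩) h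
  · rintro rfl
    refine hw ?_
    have : (i + (n - i) : ℕ) = n := by omega
    simp [stepWeight, this]
  · rw [Nat.add_mod_mod, show (i + (j + (n - i)) : ℕ) = j + n by omega, Nat.add_mod_right,
      Nat.mod_eq_of_lt j.isLt]

/-- Four consecutive vertices need at least sixteen colors. -/
lemma IsTToneColoring.sixteen_le {n k : ℕ} {f : Fin n → Finset ℕ}
    (hf : IsTToneColoring (cycleGraph n) 5 k f) (hn : 4 ≤ n) : 16 ≤ k := by
  have := hf.mul_le_of_forall_weight_le (a := 1) (b := 1) hn
    (fun i j => if (i : ℕ) < j then (if (j : ℕ) = i + 1 then 4 else 1) else 0)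
    (fun i j => j - i) (fun i j hw => ?_) (by decide +kernel)
  · have hs : ∑ i : Fin 4, ∑ j : Fin 4,
        (if (i : ℕ) < j then (if (j : ℕ) = i + 1 then 4 else 1) else 0) * ((j - i : ℕ) - 1) = 4 := by
      decide +kernel
    rw [hs] at this
    omega
  · have hij : (i : ℕ) < j := by
      by_contra hc
      simp [hc] at hw
    refine ⟨fun h => by simp [h] at hij, ?_⟩
    rw [show (i + (j - i) : ℕ) = j by omega, Nat.mod_eq_of_lt (by omega)]

lemma toneChromaticNumber_eq {V : Type*} {G : SimpleGraph V} {t k : ℕ}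
    (hex : ∃ f, IsTToneColoring G t k f)
    (hle : ∀ l f, IsTToneColoring G t l f → k ≤ l) : toneChromaticNumber G t = k :=
  IsLeast.csInf_eq ⟨hex, fun l ⟨f, hf⟩ => hle l f hf⟩

/-- Exceptional cycles: the word attains the bound coming from step weights. -/
lemma toneChromaticNumber_cycleGraph_of_stepWeight {n k : ℕ} (a b x y s : ℕ)
    (hword : IsCyclicTone k n (fun i => (exceptionalWord n).getD i ∅))
    (h : ∀ S : Finset (Fin n), a * S.card ≤ b + ∑ i ∈ S, ∑ j ∈ S, stepWeight n x y i j)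
    (hs : ∑ i : Fin n, ∑ j : Fin n, stepWeight n x y i j * ((j + (n - i)) % n - 1) = s)
    (hlt : (k - 1) * b + s < a * (n * 5)) :
    toneChromaticNumber (cycleGraph n) 5 = k := by
  refine toneChromaticNumber_eq (exists_isTToneColoring_of_exceptionalWord hword)
    fun l f hf => ?_
  have h1 := hf.mul_le_of_forall_stepWeight_le x y h
  rw [hs] at h1
  by_contra hc
  have : l * b ≤ (k - 1) * b := Nat.mul_le_mul_right _ (by omega)
  omega

/-- `τ₅(C_n) = 20` if `n = 5`; `18` if `n ∈ {4,6}`; `17` if `n ∈ {7,9}`; `15` if `n = 3`;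
else `16`. -/
theorem five_tone_cycles (n : ℕ) (hn : 3 ≤ n) :
    toneChromaticNumber (cycleGraph n) 5 =
      if n = 5 then 20
      else if n = 4 ∨ n = 6 then 18
      else if n = 7 ∨ n = 9 then 17
      else if n = 3 then 15
      else 16 := by
  by_cases h : n = 8 ∨ 10 ≤ n
  · rw [if_neg (by omega), if_neg (by omega), if_neg (by omega), if_neg (by omega)]
    exact toneChromaticNumber_eq (exists_isTToneColoring_sixteen n h)
      fun l f hf => hf.sixteen_le (by omega)
  · obtain rfl | rfl | rfl | rfl | rfl | rfl :
        n = 3 ∨ n = 4 ∨ n = 5 ∨ n = 6 ∨ n = 7 ∨ n = 9 := by omega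
    · exact toneChromaticNumber_cycleGraph_of_stepWeight (n := 3) (k := 15) 1 1 0 0 0
        (by decide +kernel) (by decide +kernel) (by decide +kernel) (by norm_num)
    · exact toneChromaticNumber_cycleGraph_of_stepWeight (n := 4) (k := 18) 2 2 1 0 4
        (by decide +kernel) (by decide +kernel) (by decide +kernel) (by norm_num)
    · exact toneChromaticNumber_cycleGraph_of_stepWeight (n := 5) (k := 20) 1 1 1 0 5
        (by decide +kernel) (by decide +kernel) (by decide +kernel) (by norm_num)
    · exact toneChromaticNumber_cycleGraph_of_stepWeight (n := 6) (k := 18) 2 2 2 1 24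
        (by decide +kernel) (by decide +kernel) (by decide +kernel) (by norm_num)
    · exact toneChromaticNumber_cycleGraph_of_stepWeight (n := 7) (k := 17) 2 3 1 1 21
        (by decide +kernel) (by decide +kernel) (by decide +kernel) (by norm_num)
    · exact toneChromaticNumber_cycleGraph_of_stepWeight (n := 9) (k := 17) 3 6 2 1 36
        (by decide +kernel) (by decide +kernel) (by decide +kernel) (by norm_num)
end

section
/- τ₅(C₉) ≥ 17; that is, the cycle on 9 vertices has no 5-tone 16-coloring. -/
open SimpleGraph

/-- An independent set of `C₉` with more than two vertices contains many pairs at distance two or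
three. -/
lemma three_mul_card_le_of_independent (s : Finset (Fin 9)) (hs : ∀ v ∈ s, v + 1 ∉ s) :
    3 * s.card ≤ 6 + 2 * (Finset.univ.filter fun v => v ∈ s ∧ v + 2 ∈ s).card +
      (Finset.univ.filter fun v => v ∈ s ∧ v + 3 ∈ s).card := by
  revert s
  decide +kernel

lemma edist_cycleGraph_nine_add_one_le (v : Fin 9) : (cycleGraph 9).edist v (v + 1) ≤ 1 := by
  have h : (cycleGraph 9).Adj v (v + 1) := by
    rw [cycleGraph_adj]
    simp
  exact (edist_eq_one_iff_adj.mpr h).le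

lemma edist_cycleGraph_nine_add_two_le (v : Fin 9) : (cycleGraph 9).edist v (v + 2) ≤ 2 := by
  have h := edist_cycleGraph_nine_add_one_le (v + 1)
  rw [add_assoc] at h
  calc (cycleGraph 9).edist v (v + 2)
      ≤ (cycleGraph 9).edist v (v + 1) + (cycleGraph 9).edist (v + 1) (v + 2) :=
        SimpleGraph.edist_triangle
    _ ≤ 1 + 1 := add_le_add (edist_cycleGraph_nine_add_one_le v) h
    _ = 2 := one_add_one_eq_two

lemma edist_cycleGraph_nine_add_three_le (v : Fin 9) : (cycleGraph 9).edist v (v + 3) ≤ 3 := by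
  have h := edist_cycleGraph_nine_add_one_le (v + 2)
  rw [add_assoc] at h
  calc (cycleGraph 9).edist v (v + 3)
      ≤ (cycleGraph 9).edist v (v + 2) + (cycleGraph 9).edist (v + 2) (v + 3) :=
        SimpleGraph.edist_triangle
    _ ≤ 2 + 1 := add_le_add (edist_cycleGraph_nine_add_two_le v) h
    _ = 3 := two_add_one_eq_three

lemma IsTToneColoring.card_inter_lt {V : Type*} {G : SimpleGraph V} {t k d : ℕ}
    {f : V → Finset ℕ} (hf : IsTToneColoring G t k f) {v w : V} (hvw : v ≠ w)
    (hd : G.edist v w ≤ d) : (f v ∩ f w).card < d := by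
  exact_mod_cast (hf.2.2 hvw).trans_le hd

lemma IsTToneColoring.mono {V : Type*} {G : SimpleGraph V} {t k l : ℕ} {f : V → Finset ℕ}
    (hf : IsTToneColoring G t k f) (hkl : k ≤ l) : IsTToneColoring G t l f :=
  ⟨fun v => (hf.1 v).trans (Finset.Icc_subset_Icc_right hkl), hf.2⟩

/-- Double counting of the incidences between indices and elements. -/
lemma sum_card_eq_sum_card_filter_mem {ι α : Type*} [Fintype ι] [DecidableEq α]
    {g : ι → Finset α} {s : Finset α} (hg : ∀ i, g i ⊆ s) :
    ∑ i, (g i).card = ∑ c ∈ s, (Finset.univ.filter fun i => c ∈ g i).card := by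
  have h := Finset.sum_card_bipartiteAbove_eq_sum_card_bipartiteBelow
    (s := (Finset.univ : Finset ι)) (t := s) fun i c => c ∈ g i
  simp only [Finset.bipartiteAbove, Finset.bipartiteBelow] at h
  rw [← h]
  refine Finset.sum_congr rfl fun i _ => ?_
  rw [Finset.filter_mem_eq_inter, Finset.inter_eq_right.mpr (hg i)]

lemma not_isTToneColoring_cycleGraph_nine (f : Fin 9 → Finset ℕ) :
    ¬ IsTToneColoring (cycleGraph 9) 5 16 f := by
  intro hf
  have hinter (d : Fin 9) (v : Fin 9) : f v ∩ f (v + d) ⊆ Finset.Icc 1 16 :=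
    Finset.inter_subset_left.trans (hf.1 v)
  have hone (v : Fin 9) : f v ∩ f (v + 1) = ∅ := by
    rw [← Finset.card_eq_zero]
    have := hf.card_inter_lt (d := 1) (by simp) (edist_cycleGraph_nine_add_one_le v)
    omega
  have htwo : ∑ v, (f v ∩ f (v + 2)).card ≤ 9 := by
    have h := Finset.sum_le_card_nsmul Finset.univ (fun v => (f v ∩ f (v + 2)).card) 1
      fun v _ => Nat.le_of_lt_succ <|
        hf.card_inter_lt (d := 2) (by simp) (edist_cycleGraph_nine_add_two_le v)
    simpa using h
  have hthree : ∑ v, (f v ∩ f (v + 3)).card ≤ 18 := by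
    have h := Finset.sum_le_card_nsmul Finset.univ (fun v => (f v ∩ f (v + 3)).card) 2
      fun v _ => Nat.le_of_lt_succ <|
        hf.card_inter_lt (d := 3) (by simp) (edist_cycleGraph_nine_add_three_le v)
    simpa using h
  have htotal : ∑ v, (f v).card = 45 := by simp [hf.2.1]
  rw [sum_card_eq_sum_card_filter_mem (hinter 2)] at htwo
  rw [sum_card_eq_sum_card_filter_mem (hinter 3)] at hthree
  rw [sum_card_eq_sum_card_filter_mem hf.1] at htotal
  have hcolor := Finset.sum_le_sum fun c (_ : c ∈ Finset.Icc 1 16) =>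
    three_mul_card_le_of_independent (Finset.univ.filter fun v => c ∈ f v) fun v hv hv' => by
      have hc : c ∈ f v ∩ f (v + 1) :=
        Finset.mem_inter.mpr ⟨(Finset.mem_filter.mp hv).2, (Finset.mem_filter.mp hv').2⟩
      simp [hone] at hc
  simp only [Finset.sum_add_distrib, ← Finset.mul_sum, Finset.mem_filter, Finset.mem_univ,
    true_and, Finset.sum_const, Nat.card_Icc, smul_eq_mul, ← Finset.mem_inter] at hcolor
  omega

lemma exists_isTToneColoring_fin {n : ℕ} (G : SimpleGraph (Fin n)) (t : ℕ) :
    ∃ k, ∃ f : Fin n → Finset ℕ, IsTToneColoring G t k f := by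
  refine ⟨t * n, fun v => Finset.Ioc (t * v) (t * (v + 1)), fun v c hc => ?_, fun v => ?_,
    fun v w hvw => ?_⟩
  · have : t * (v + 1) ≤ t * n := Nat.mul_le_mul_left t v.isLt
    simp only [Finset.mem_Ioc, Finset.mem_Icc] at hc ⊢
    omega
  · simp [mul_add]
  · have h : Finset.Ioc (t * (v : ℕ)) (t * (v + 1)) ∩ Finset.Ioc (t * (w : ℕ)) (t * (w + 1)) =
        ∅ := by
      ext c
      simp only [Finset.mem_inter, Finset.mem_Ioc, Finset.notMem_empty, iff_false]
      rintro ⟨⟨hv, hv'⟩, hw, hw'⟩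
      have hvw' := Nat.lt_of_mul_lt_mul_left (hv.trans_le hw')
      have hwv' := Nat.lt_of_mul_lt_mul_left (hw.trans_le hv')
      exact hvw (Fin.ext (by omega))
    simpa [h] using edist_pos_of_ne hvw

/-- `τ₅(C₉) ≥ 17`; that is, `C₉` has no 5-tone 16-coloring. -/
theorem five_tone_C9_lower :
    17 ≤ toneChromaticNumber (cycleGraph 9) 5 ∧
      ¬ ∃ f : Fin 9 → Finset ℕ, IsTToneColoring (cycleGraph 9) 5 16 f := by
  refine ⟨le_csInf (exists_isTToneColoring_fin _ 5) ?_, ?_⟩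
  · rintro k ⟨f, hf⟩
    by_contra! hk
    exact not_isTToneColoring_cycleGraph_nine f (hf.mono (Nat.le_of_lt_succ hk))
  · rintro ⟨f, hf⟩
    exact not_isTToneColoring_cycleGraph_nine f hf
end

section
/- τ₃(P_m □ P_n) = 10 for all integers m and n with 2 ≤ m ≤ n. -/
open SimpleGraph

/-- In a `t`-tone coloring, the labels of adjacent vertices are disjoint. -/
theorem IsTToneColoring.disjoint_of_adj {V : Type*} {G : SimpleGraph V} {t k : ℕ}
    {f : V → Finset ℕ} (hf : IsTToneColoring G t k f) {v w : V} (h : G.Adj v w) :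
    Disjoint (f v) (f w) := by
  have h1 := hf.2.2 h.ne
  rw [edist_eq_one_iff_adj.2 h] at h1
  rw [Finset.disjoint_iff_inter_eq_empty, ← Finset.card_eq_zero]
  have h2 : (f v ∩ f w).card < 1 := by exact_mod_cast h1
  omega

/-- In a `t`-tone coloring, the labels of two distinct vertices with a common neighbor share at
most one color. -/
theorem IsTToneColoring.card_inter_le_one {V : Type*} {G : SimpleGraph V} {t k : ℕ}
    {f : V → Finset ℕ} (hf : IsTToneColoring G t k f) {u v w : V} (hne : u ≠ w)
    (huv : G.Adj u v) (hvw : G.Adj v w) : (f u ∩ f w).card ≤ 1 := by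
  have h1 := (hf.2.2 hne).trans_le (Walk.edist_le (.cons huv (.cons hvw .nil)))
  have h2 : (f u ∩ f w).card < 2 := by exact_mod_cast h1
  omega

/-- A graph containing a 4-cycle has no 3-tone coloring with fewer than ten colors. -/
theorem IsTToneColoring.ten_le_of_four_cycle {V : Type*} {G : SimpleGraph V} {k : ℕ}
    {f : V → Finset ℕ} (hf : IsTToneColoring G 3 k f) {a b c d : V} (hac : a ≠ c) (hbd : b ≠ d)
    (hab : G.Adj a b) (hbc : G.Adj b c) (hcd : G.Adj c d) (hda : G.Adj d a) : 10 ≤ k := by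
  have h1 := hf.card_inter_le_one hac hab hbc
  have h2 := hf.card_inter_le_one hbd hbc hcd
  have h3 : Disjoint (f a ∪ f c) (f b ∪ f d) := by
    simp only [Finset.disjoint_union_left, Finset.disjoint_union_right]
    exact ⟨⟨hf.disjoint_of_adj hab, hf.disjoint_of_adj hbc.symm⟩,
      hf.disjoint_of_adj hda.symm, hf.disjoint_of_adj hcd⟩
  have h4 := Finset.card_le_card (Finset.union_subset
    (Finset.union_subset (hf.1 a) (hf.1 c)) (Finset.union_subset (hf.1 b) (hf.1 d)))
  rw [Finset.card_union_of_disjoint h3, Nat.card_Icc] at h4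
  have h5 := Finset.card_union_add_card_inter (f a) (f c)
  have h6 := Finset.card_union_add_card_inter (f b) (f d)
  simp only [hf.2.1] at h5 h6
  omega

/-- The length of a walk in the grid is at least the taxicab distance between its ends. -/
theorem taxicab_le_walk_length {m n : ℕ} {v w : Fin m × Fin n}
    (p : (pathGraph m □ pathGraph n).Walk v w) :
    ((w.1 : ℤ) - v.1).natAbs + ((w.2 : ℤ) - v.2).natAbs ≤ p.length := by
  induction p with
  | nil => simp
  | cons h p ih =>
    simp only [boxProd_adj, pathGraph_adj, Fin.ext_iff] at h
    rw [Walk.length_cons]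
    omega

theorem taxicab_le_edist {m n : ℕ} (v w : Fin m × Fin n) :
    ((((w.1 : ℤ) - v.1).natAbs + ((w.2 : ℤ) - v.2).natAbs : ℕ) : ℕ∞) ≤
      (pathGraph m □ pathGraph n).edist v w :=
  le_iInf fun p => Nat.cast_le.2 (taxicab_le_walk_length p)

/-- A cyclic sequence of labels such that `(x, y) ↦ toneLabel (x + 4 * y)` is a 3-tone coloring
of the infinite grid. -/
def toneLabel : ZMod 21 → Finset ℕ :=
  ![{1, 2, 3}, {5, 7, 8}, {3, 4, 10}, {2, 5, 6}, {4, 7, 9}, {1, 6, 10}, {2, 8, 9}, {1, 3, 7},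
    {5, 8, 10}, {2, 3, 4}, {5, 6, 7}, {4, 9, 10}, {1, 2, 6}, {7, 8, 9}, {1, 3, 10}, {2, 5, 8},
    {3, 4, 7}, {5, 6, 10}, {2, 4, 9}, {1, 6, 7}, {8, 9, 10}]

theorem toneLabel_subset : ∀ a, toneLabel a ⊆ Finset.Icc 1 10 := by decide +kernel

theorem card_toneLabel : ∀ a, (toneLabel a).card = 3 := by decide +kernel

theorem card_toneLabel_inter_lt_of_small :
    ∀ d ∈ Finset.Icc (-3 : ℤ) 3, ∀ e ∈ Finset.Icc (-3 : ℤ) 3, 0 < d.natAbs + e.natAbs →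
      ∀ a : ZMod 21, (toneLabel a ∩ toneLabel (a + (d + 4 * e))).card < d.natAbs + e.natAbs := by
  decide +kernel

theorem card_toneLabel_inter_lt (d e : ℤ) (h : 0 < d.natAbs + e.natAbs) (a : ZMod 21) :
    (toneLabel a ∩ toneLabel (a + (d + 4 * e))).card < d.natAbs + e.natAbs := by
  by_cases hle : d.natAbs + e.natAbs ≤ 3
  · exact card_toneLabel_inter_lt_of_small d (by rw [Finset.mem_Icc]; omega) e
      (by rw [Finset.mem_Icc]; omega) h a
  · have := Finset.card_le_card
      (Finset.inter_subset_left (s₁ := toneLabel a) (s₂ := toneLabel (a + (d + 4 * e))))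
    rw [card_toneLabel] at this
    omega

theorem isTToneColoring_grid (m n : ℕ) :
    IsTToneColoring (pathGraph m □ pathGraph n) 3 10
      fun v => toneLabel ((v.1 : ℕ) + 4 * (v.2 : ℕ)) := by
  refine ⟨fun _ => toneLabel_subset _, fun _ => card_toneLabel _, fun v w hvw => ?_⟩
  refine lt_of_lt_of_le (Nat.cast_lt.2 ?_) (taxicab_le_edist v w)
  have hpos : 0 < ((w.1 : ℤ) - v.1).natAbs + ((w.2 : ℤ) - v.2).natAbs := by
    rw [Ne, Prod.ext_iff, Fin.ext_iff, Fin.ext_iff] at hvw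
    omega
  convert card_toneLabel_inter_lt _ _ hpos ((v.1 : ℕ) + 4 * (v.2 : ℕ)) using 4
  push_cast
  ring

/-- `τ₃(P_m □ P_n) = 10` for all `2 ≤ m ≤ n`. -/
theorem three_tone_grid (m n : ℕ) (hm : 2 ≤ m) (hmn : m ≤ n) :
    toneChromaticNumber (pathGraph m □ pathGraph n) 3 = 10 := by
  refine IsLeast.csInf_eq ⟨⟨_, isTToneColoring_grid m n⟩, ?_⟩
  rintro k ⟨f, hf⟩
  let x (i : Fin 2) : Fin m := i.castLE hm
  let y (i : Fin 2) : Fin n := i.castLE (hm.trans hmn)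
  apply hf.ten_le_of_four_cycle (a := (x 0, y 0)) (b := (x 1, y 0)) (c := (x 1, y 1))
    (d := (x 0, y 1)) <;>
  simp [x, y, boxProd_adj, pathGraph_adj, Fin.ext_iff]
end

section
/- τ₄(P_m □ P_n) = 14 for all integers m and n with 2 ≤ m ≤ n. -/
open SimpleGraph

/-- A grid walk cannot be shorter than the Manhattan distance between its endpoints. -/
theorem manhattan_le_length {m n : ℕ} {v w : Fin m × Fin n}
    (p : (pathGraph m □ pathGraph n).Walk v w) :
    Nat.dist v.1 w.1 + Nat.dist v.2 w.2 ≤ p.length := by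
  induction p with
  | nil => simp
  | cons h p ih =>
    rw [boxProd_adj, pathGraph_adj, pathGraph_adj, Fin.ext_iff, Fin.ext_iff] at h
    rw [Walk.length_cons]
    unfold Nat.dist at *
    omega

theorem manhattan_le_edist {m n : ℕ} (v w : Fin m × Fin n) :
    ((Nat.dist v.1 w.1 + Nat.dist v.2 w.2 : ℕ) : ℕ∞) ≤
      (pathGraph m □ pathGraph n).edist v w :=
  le_iInf fun p => Nat.cast_le.2 (manhattan_le_length p)

/-- One period of a doubly `7`-periodic `4`-tone `14`-coloring of the infinite grid. -/
def toneTable : List (List (Finset ℕ)) :=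
  [[{1, 2, 3, 4}, {8, 12, 13, 14}, {3, 6, 7, 9}, {4, 5, 8, 10}, {1, 9, 11, 13}, {2, 5, 7, 12}, {6, 10, 11, 14}],
   [{5, 6, 7, 8}, {4, 9, 10, 11}, {1, 2, 5, 13}, {7, 11, 12, 14}, {2, 3, 6, 10}, {1, 4, 8, 14}, {3, 9, 12, 13}],
   [{1, 11, 13, 14}, {2, 3, 7, 12}, {6, 8, 10, 14}, {1, 3, 4, 9}, {5, 8, 12, 13}, {6, 7, 9, 11}, {2, 4, 5, 10}],
   [{3, 6, 9, 10}, {1, 4, 5, 8}, {9, 11, 12, 13}, {2, 5, 6, 7}, {4, 10, 11, 14}, {1, 2, 3, 13}, {7, 8, 12, 14}],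
   [{2, 5, 12, 13}, {6, 7, 11, 14}, {2, 3, 4, 10}, {1, 8, 13, 14}, {3, 7, 9, 12}, {5, 6, 8, 10}, {1, 4, 9, 11}],
   [{4, 8, 10, 14}, {1, 3, 9, 13}, {5, 7, 8, 12}, {6, 9, 10, 11}, {1, 2, 4, 5}, {11, 12, 13, 14}, {2, 3, 6, 7}],
   [{7, 9, 11, 12}, {2, 5, 6, 10}, {1, 4, 11, 14}, {2, 3, 12, 13}, {6, 7, 8, 14}, {3, 4, 9, 10}, {1, 5, 8, 13}]]

/-- The doubly `7`-periodic labelling of the quarter plane obtained from `toneTable`. -/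
def periodicTone (x y : ℕ) : Finset ℕ :=
  (toneTable.getD (x % 7) []).getD (y % 7) ∅

theorem periodicTone_mod (x y : ℕ) : periodicTone (x % 7) (y % 7) = periodicTone x y := by
  simp [periodicTone]

theorem periodicTone_subset (x y : ℕ) : periodicTone x y ⊆ Finset.Icc 1 14 := by
  have key : ∀ x y : Fin 7, periodicTone x y ⊆ Finset.Icc 1 14 := by decide +kernel
  rw [← periodicTone_mod]
  exact key ⟨x % 7, Nat.mod_lt _ (by norm_num)⟩ ⟨y % 7, Nat.mod_lt _ (by norm_num)⟩

theorem card_periodicTone (x y : ℕ) : (periodicTone x y).card = 4 := by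
  have key : ∀ x y : Fin 7, (periodicTone x y).card = 4 := by decide +kernel
  rw [← periodicTone_mod]
  exact key ⟨x % 7, Nat.mod_lt _ (by norm_num)⟩ ⟨y % 7, Nat.mod_lt _ (by norm_num)⟩

theorem card_periodicTone_inter_lt_add (x y a b : ℕ) (h : 0 < a + b) :
    (periodicTone x y ∩ periodicTone (x + a) (y + b)).card < a + b ∧
      (periodicTone x (y + b) ∩ periodicTone (x + a) y).card < a + b := by
  have key : ∀ x y : Fin 7, ∀ a b : Fin 5, 0 < a.val + b.val → a.val + b.val ≤ 4 →
      (periodicTone x y ∩ periodicTone (x + a : ℕ) (y + b : ℕ)).card < a.val + b.val ∧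
      (periodicTone x (y + b : ℕ) ∩ periodicTone (x + a : ℕ) y).card < a.val + b.val := by
    decide +kernel
  by_cases hab : a + b ≤ 4
  · have := key ⟨x % 7, Nat.mod_lt _ (by norm_num)⟩ ⟨y % 7, Nat.mod_lt _ (by norm_num)⟩
      ⟨a, by omega⟩ ⟨b, by omega⟩ h hab
    simpa [periodicTone] using this
  · have h₁ := Finset.card_le_card (Finset.inter_subset_left
      (s₁ := periodicTone x y) (s₂ := periodicTone (x + a) (y + b)))
    have h₂ := Finset.card_le_card (Finset.inter_subset_left
      (s₁ := periodicTone x (y + b)) (s₂ := periodicTone (x + a) y))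
    rw [card_periodicTone] at h₁ h₂
    omega

theorem card_periodicTone_inter_lt_manhattan (x y x' y' : ℕ)
    (h : 0 < Nat.dist x x' + Nat.dist y y') :
    (periodicTone x y ∩ periodicTone x' y').card < Nat.dist x x' + Nat.dist y y' := by
  wlog hx : x ≤ x' generalizing x y x' y'
  · rw [Finset.inter_comm, Nat.dist_comm x, Nat.dist_comm y] at *
    exact this _ _ _ _ h (by omega)
  obtain ⟨a, rfl⟩ := Nat.exists_eq_add_of_le hx
  have ha : Nat.dist x (x + a) = a := by simp [Nat.dist]
  rcases le_total y y' with hy | hy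
  · obtain ⟨b, rfl⟩ := Nat.exists_eq_add_of_le hy
    have hb : Nat.dist y (y + b) = b := by simp [Nat.dist]
    rw [ha, hb] at h ⊢
    exact (card_periodicTone_inter_lt_add x y a b h).1
  · obtain ⟨b, rfl⟩ := Nat.exists_eq_add_of_le hy
    have hb : Nat.dist (y' + b) y' = b := by simp [Nat.dist]
    rw [ha, hb] at h ⊢
    exact (card_periodicTone_inter_lt_add x y' a b h).2

theorem isTToneColoring_periodicTone (m n : ℕ) :
    IsTToneColoring (pathGraph m □ pathGraph n) 4 14 fun v => periodicTone v.1 v.2 := by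
  refine ⟨fun v => periodicTone_subset _ _, fun v => card_periodicTone _ _, fun v w hvw => ?_⟩
  refine lt_of_lt_of_le (Nat.cast_lt.2 ?_) (manhattan_le_edist v w)
  apply card_periodicTone_inter_lt_manhattan
  rw [Nat.pos_iff_ne_zero]
  intro h
  apply hvw
  ext
  · exact Nat.eq_of_dist_eq_zero (by omega)
  · exact Nat.eq_of_dist_eq_zero (by omega)

namespace IsTToneColoring

variable {V : Type*} {G : SimpleGraph V} {t k : ℕ} {f : V → Finset ℕ}

theorem disjoint_of_adj_s14 (hf : IsTToneColoring G t k f) {v w : V} (h : G.Adj v w) :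
    Disjoint (f v) (f w) := by
  have := hf.2.2 h.ne
  rw [edist_eq_one_iff_adj.2 h] at this
  rw [Finset.disjoint_iff_inter_eq_empty, ← Finset.card_eq_zero, ← Nat.lt_one_iff]
  exact_mod_cast this

theorem two_mul_le_card_union (hf : IsTToneColoring G t k f) {v w u : V} (h₁ : G.Adj v u)
    (h₂ : G.Adj u w) (hvw : v ≠ w) : 2 * t ≤ (f v ∪ f w).card + 1 := by
  have h := (hf.2.2 hvw).trans_le (edist_le (.cons h₁ (.cons h₂ .nil)))
  have h' : (f v ∩ f w).card < 2 := by exact_mod_cast h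
  have := Finset.card_union_add_card_inter (f v) (f w)
  rw [hf.2.1, hf.2.1] at this
  omega

/-- The two diagonals of a `4`-cycle use disjoint sets of colors, each of size at least
`2 * t - 1`. -/
theorem four_mul_le_of_cycle (hf : IsTToneColoring G t k f) {a b c d : V} (hab : G.Adj a b)
    (hbc : G.Adj b c) (hcd : G.Adj c d) (hda : G.Adj d a) (hac : a ≠ c) (hbd : b ≠ d) :
    4 * t ≤ k + 2 := by
  have h₁ := hf.two_mul_le_card_union hab hbc hac
  have h₂ := hf.two_mul_le_card_union hbc hcd hbd
  have hdisj : Disjoint (f a ∪ f c) (f b ∪ f d) := by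
    simp only [Finset.disjoint_union_left, Finset.disjoint_union_right]
    exact ⟨⟨hf.disjoint_of_adj_s14 hab, hf.disjoint_of_adj_s14 hbc.symm⟩,
      hf.disjoint_of_adj_s14 hda.symm, hf.disjoint_of_adj_s14 hcd⟩
  have hsub : (f a ∪ f c) ∪ (f b ∪ f d) ⊆ Finset.Icc 1 k :=
    Finset.union_subset (Finset.union_subset (hf.1 a) (hf.1 c))
      (Finset.union_subset (hf.1 b) (hf.1 d))
  have := Finset.card_le_card hsub
  rw [Finset.card_union_of_disjoint hdisj, Nat.card_Icc] at this
  omega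

end IsTToneColoring

/-- `τ₄(P_m □ P_n) = 14` for all `2 ≤ m ≤ n`. -/
theorem four_tone_grid (m n : ℕ) (hm : 2 ≤ m) (hmn : m ≤ n) :
    toneChromaticNumber (pathGraph m □ pathGraph n) 4 = 14 := by
  have hcol : ∃ f, IsTToneColoring (pathGraph m □ pathGraph n) 4 14 f :=
    ⟨_, isTToneColoring_periodicTone m n⟩
  refine le_antisymm (Nat.sInf_le hcol) (le_csInf ⟨14, hcol⟩ ?_)
  rintro k ⟨f, hf⟩
  have := hf.four_mul_le_of_cycle (a := (⟨0, by omega⟩, ⟨0, by omega⟩))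
    (b := (⟨1, by omega⟩, ⟨0, by omega⟩)) (c := (⟨1, by omega⟩, ⟨1, by omega⟩))
    (d := (⟨0, by omega⟩, ⟨1, by omega⟩))
    (by simp [pathGraph_adj]) (by simp [pathGraph_adj]) (by simp [pathGraph_adj])
    (by simp [pathGraph_adj]) (by simp) (by simp)
  omega
end

section
/- 20 ≤ τ₅(P_m □ P_n) ≤ 22 for all integers m and n with 2 ≤ m < n. -/
open SimpleGraph

/-- The distance in a path graph is the absolute difference of the positions. -/
theorem edist_pathGraph {n : ℕ} (i j : Fin n) :
    (pathGraph n).edist i j = (Nat.dist i j : ℕ∞) := by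
  apply le_antisymm
  · have key : ∀ (d a : ℕ) (h : a + d < n),
        (pathGraph n).edist ⟨a, by omega⟩ ⟨a + d, h⟩ ≤ (d : ℕ∞) := by
      intro d
      induction d with
      | zero => intro a h; simp
      | succ d ih =>
        intro a h
        refine (SimpleGraph.edist_triangle (v := ⟨a + d, by omega⟩)).trans ?_
        push_cast
        refine add_le_add (ih a (by omega)) (le_of_eq ?_)
        rw [edist_eq_one_iff_adj, pathGraph_adj]
        exact Or.inl rfl
    have mono : ∀ i j : Fin n, i ≤ j → (pathGraph n).edist i j ≤ (Nat.dist i j : ℕ∞) := by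
      intro i j hij
      have hij' : (i : ℕ) ≤ j := hij
      have hj : (i : ℕ) + (j - i) = j := by omega
      have h := key (j - i) i (by omega)
      simp only [hj] at h
      rwa [Nat.dist_eq_sub_of_le hij']
    rcases le_total i j with h | h
    · exact mono i j h
    · rw [edist_comm, Nat.dist_comm]
      exact mono j i h
  · have walk : ∀ {i j : Fin n} (p : (pathGraph n).Walk i j), Nat.dist i j ≤ p.length := by
      intro i j p
      induction p with
      | nil => simp
      | cons h p ih =>
        rw [pathGraph_adj] at h
        rw [Walk.length_cons]
        simp only [Nat.dist] at *
        omega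
    rw [edist_eq_sInf]
    refine le_sInf ?_
    rintro _ ⟨p, rfl⟩
    exact Nat.cast_le.2 (walk p)

/-- The distance in a grid is the `ℓ¹` distance. -/
theorem edist_grid {m n : ℕ} (v w : Fin m × Fin n) :
    (pathGraph m □ pathGraph n).edist v w =
      ((Nat.dist v.1 w.1 + Nat.dist v.2 w.2 : ℕ) : ℕ∞) := by
  rw [edist_boxProd, edist_pathGraph, edist_pathGraph, Nat.cast_add]

/-- A set with few repeated differences modulo `22`, translated by `s`. -/
def cyclicLabel (s : ℕ) : Finset ℕ :=
  ({0, 2, 8, 11, 15} : Finset ℕ).image fun b => (b + s) % 22 + 1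

theorem cyclicLabel_mod (s : ℕ) : cyclicLabel (s % 22) = cyclicLabel s := by
  simp [cyclicLabel]

theorem cyclicLabel_subset (s : ℕ) : cyclicLabel s ⊆ Finset.Icc 1 22 := by
  intro c hc
  simp only [cyclicLabel, Finset.mem_image] at hc
  obtain ⟨b, -, rfl⟩ := hc
  rw [Finset.mem_Icc]
  omega

theorem card_cyclicLabel (s : ℕ) : (cyclicLabel s).card = 5 := by
  rw [← cyclicLabel_mod]
  have h : ∀ r < 22, (cyclicLabel r).card = 5 := by decide +kernel
  exact h _ (Nat.mod_lt _ (by norm_num))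

/-- In the labeling `(x, y) ↦ cyclicLabel (x + 5 * y)`, vertices at `ℓ¹` distance at most `5`
share fewer labels than their distance. -/
theorem card_cyclicLabel_inter_lt :
    ∀ s < 22, ∀ x < 11, ∀ y < 11, 0 < Nat.dist x 5 + Nat.dist y 5 →
      (cyclicLabel s ∩ cyclicLabel ((s + x + 5 * y + 14) % 22)).card <
        Nat.dist x 5 + Nat.dist y 5 := by
  decide +kernel

theorem isTToneColoring_cyclicLabel (m n : ℕ) :
    IsTToneColoring (pathGraph m □ pathGraph n) 5 22
      fun v => cyclicLabel (v.1 + 5 * v.2) := by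
  refine ⟨fun v => cyclicLabel_subset _, fun v => card_cyclicLabel _, ?_⟩
  rintro ⟨⟨a, ha⟩, ⟨b, hb⟩⟩ ⟨⟨c, hc⟩, ⟨d, hd⟩⟩ hne
  rw [edist_grid, Nat.cast_lt]
  simp only [ne_eq, Prod.mk.injEq, Fin.mk.injEq] at hne ⊢
  by_cases h : Nat.dist a c + Nat.dist b d ≤ 5
  · have key := card_cyclicLabel_inter_lt ((a + 5 * b) % 22) (Nat.mod_lt _ (by norm_num))
      (c + 5 - a) (by simp only [Nat.dist] at h; omega)
      (d + 5 - b) (by simp only [Nat.dist] at h; omega)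
    have hx : Nat.dist (c + 5 - a) 5 = Nat.dist a c := by simp only [Nat.dist] at *; omega
    have hy : Nat.dist (d + 5 - b) 5 = Nat.dist b d := by simp only [Nat.dist] at *; omega
    have hs : ((a + 5 * b) % 22 + (c + 5 - a) + 5 * (d + 5 - b) + 14) % 22 =
        (c + 5 * d) % 22 := by
      simp only [Nat.dist] at h; omega
    rw [hx, hy, hs, cyclicLabel_mod, cyclicLabel_mod] at key
    exact key (by simp only [Nat.dist]; omega)
  · have := Finset.card_le_card
      (Finset.inter_subset_left (s₁ := cyclicLabel (a + 5 * b)) (s₂ := cyclicLabel (c + 5 * d)))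
    rw [card_cyclicLabel] at this
    omega

/-- Two vertices of the grid share fewer labels than their `ℓ¹` distance. -/
theorem IsTToneColoring.card_inter_lt_s15 {m n t k : ℕ} {f : Fin m × Fin n → Finset ℕ}
    (hf : IsTToneColoring (pathGraph m □ pathGraph n) t k f) {v w : Fin m × Fin n}
    (hne : v ≠ w) :
    (f v ∩ f w).card < Nat.dist v.1 w.1 + Nat.dist v.2 w.2 := by
  have h := hf.2.2 hne
  rwa [edist_grid, Nat.cast_lt] at h

/-- Bonferroni's inequality for a sequence of finite sets. -/
theorem sum_card_le_card_biUnion_add {α : Type*} [DecidableEq α] (A : ℕ → Finset α) (r : ℕ) :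
    ∑ i ∈ Finset.range r, (A i).card ≤ ((Finset.range r).biUnion A).card +
      ∑ i ∈ Finset.range r, ∑ j ∈ Finset.range i, (A i ∩ A j).card := by
  induction r with
  | zero => simp
  | succ r ih =>
    rw [Finset.sum_range_succ, Finset.sum_range_succ, Finset.range_add_one,
      Finset.biUnion_insert]
    have h₁ := Finset.card_union_add_card_inter (A r) ((Finset.range r).biUnion A)
    have h₂ : (A r ∩ (Finset.range r).biUnion A).card ≤
        ∑ j ∈ Finset.range r, (A r ∩ A j).card := by
      rw [Finset.inter_biUnion]
      exact Finset.card_biUnion_le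
    omega

/-- The six labels of a `2 × 3` subgrid already use at least `20` colors. -/
theorem IsTToneColoring.twenty_le {m n k : ℕ} {f : Fin m × Fin n → Finset ℕ}
    (hf : IsTToneColoring (pathGraph m □ pathGraph n) 5 k f) (hm : 2 ≤ m) (hn : 3 ≤ n) :
    20 ≤ k := by
  let v : ℕ → Fin m × Fin n := fun i =>
    (⟨i % 2, by omega⟩, ⟨i % 3, by omega⟩)
  have hsub : (Finset.range 6).biUnion (fun i => f (v i)) ⊆ Finset.Icc 1 k :=
    Finset.biUnion_subset.2 fun i _ => hf.1 (v i)
  have hcard := Finset.card_le_card hsub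
  rw [Nat.card_Icc] at hcard
  have hsum := sum_card_le_card_biUnion_add (fun i => f (v i)) 6
  have hpairs : ∑ i ∈ Finset.range 6, ∑ j ∈ Finset.range i, (f (v i) ∩ f (v j)).card ≤
      ∑ i ∈ Finset.range 6, ∑ j ∈ Finset.range i,
        (Nat.dist (i % 2) (j % 2) + Nat.dist (i % 3) (j % 3) - 1) := by
    refine Finset.sum_le_sum fun i hi => Finset.sum_le_sum fun j hj => ?_
    rw [Finset.mem_range] at hi hj
    have hne : v i ≠ v j := by
      simp only [v, ne_eq, Prod.mk.injEq, Fin.mk.injEq]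
      omega
    exact Nat.le_sub_one_of_lt (hf.card_inter_lt_s15 hne)
  have htotal : ∑ i ∈ Finset.range 6, ∑ j ∈ Finset.range i,
      (Nat.dist (i % 2) (j % 2) + Nat.dist (i % 3) (j % 3) - 1) = 10 := by decide
  simp only [hf.2.1, Finset.sum_const, Finset.card_range, smul_eq_mul] at hsum
  omega

/-- `20 ≤ τ₅(P_m □ P_n) ≤ 22` for all `2 ≤ m < n`. -/
theorem five_tone_grid (m n : ℕ) (hm : 2 ≤ m) (hmn : m < n) :
    20 ≤ toneChromaticNumber (pathGraph m □ pathGraph n) 5 ∧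
      toneChromaticNumber (pathGraph m □ pathGraph n) 5 ≤ 22 := by
  have hmem : 22 ∈ {k | ∃ f, IsTToneColoring (pathGraph m □ pathGraph n) 5 k f} :=
    ⟨_, isTToneColoring_cyclicLabel m n⟩
  refine ⟨le_csInf ⟨22, hmem⟩ ?_, Nat.sInf_le hmem⟩
  rintro k ⟨f, hf⟩
  exact hf.twenty_le hm (by omega)
end

section
/- For every positive integer t, τ_t(C₄) = 4t − 2, where C₄ is the cycle on 4 vertices. -/
open SimpleGraph

theorem edist_le_two_of_adj_of_adj {V : Type*} {G : SimpleGraph V} {u v w : V}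
    (huv : G.Adj u v) (hvw : G.Adj v w) : G.edist u w ≤ 2 := by
  calc G.edist u w ≤ G.edist u v + G.edist v w := SimpleGraph.edist_triangle
    _ = 2 := by
      rw [edist_eq_one_iff_adj.mpr huv, edist_eq_one_iff_adj.mpr hvw]
      norm_num

theorem one_lt_edist_of_not_adj {V : Type*} {G : SimpleGraph V} {v w : V} (hne : v ≠ w)
    (h : ¬ G.Adj v w) : 1 < G.edist v w := by
  refine lt_of_le_of_ne ?_ fun he => h (edist_eq_one_iff_adj.mp he.symm)
  exact Order.one_le_iff_pos.mpr (edist_pos_of_ne hne)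

theorem IsTToneColoring.four_mul_sub_two_le {t k : ℕ} {f : Fin 4 → Finset ℕ}
    (hf : IsTToneColoring (cycleGraph 4) t k f) : 4 * t - 2 ≤ k := by
  obtain ⟨hsub, hcard, hdist⟩ := hf
  have disj : ∀ v w : Fin 4, (cycleGraph 4).Adj v w → Disjoint (f v) (f w) := by
    intro v w h
    have h' := hdist h.ne
    rw [edist_eq_one_iff_adj.mpr h, Order.lt_one_iff] at h'
    rw [Finset.disjoint_iff_inter_eq_empty, ← Finset.card_eq_zero]
    exact_mod_cast h'
  have union : ∀ u v w : Fin 4, u ≠ w → (cycleGraph 4).Adj u v → (cycleGraph 4).Adj v w →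
      2 * t ≤ (f u ∪ f w).card + 1 := by
    intro u v w huw huv hvw
    have h : ((f u ∩ f w).card : ℕ∞) < 2 :=
      (hdist huw).trans_le (edist_le_two_of_adj_of_adj huv hvw)
    have h' : (f u ∩ f w).card < 2 := by exact_mod_cast h
    have := Finset.card_union_add_card_inter (f u) (f w)
    rw [hcard, hcard] at this
    omega
  have h02 := union 0 1 2 (by decide) (by decide) (by decide)
  have h13 := union 1 2 3 (by decide) (by decide) (by decide)
  have hd : Disjoint (f 0 ∪ f 2) (f 1 ∪ f 3) := by
    simp only [Finset.disjoint_union_left, Finset.disjoint_union_right]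
    exact ⟨⟨disj _ _ (by decide), disj _ _ (by decide)⟩,
      ⟨disj _ _ (by decide), disj _ _ (by decide)⟩⟩
  have hle : ((f 0 ∪ f 2) ∪ (f 1 ∪ f 3)).card ≤ (Finset.Icc 1 k).card :=
    Finset.card_le_card (Finset.union_subset (Finset.union_subset (hsub 0) (hsub 2))
      (Finset.union_subset (hsub 1) (hsub 3)))
  rw [Finset.card_union_of_disjoint hd, Nat.card_Icc] at hle
  omega

theorem exists_isTToneColoring_cycleGraph_four {t : ℕ} (ht : 0 < t) :
    ∃ f, IsTToneColoring (cycleGraph 4) t (4 * t - 2) f := by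
  let s : Fin 4 → ℕ := ![1, 2 * t, t, 3 * t - 1]
  have inter : ∀ v w, Finset.Icc (s v) (s v + t - 1) ∩ Finset.Icc (s w) (s w + t - 1) =
      Finset.Icc (max (s v) (s w)) (min (s v + t - 1) (s w + t - 1)) := by
    intro v w
    ext x
    simp only [Finset.mem_inter, Finset.mem_Icc, max_le_iff, le_min_iff]
    tauto
  have adj : ∀ v w : Fin 4, (cycleGraph 4).Adj v w ↔ v.val % 2 ≠ w.val % 2 := by decide
  refine ⟨fun v => Finset.Icc (s v) (s v + t - 1), fun v => ?_, fun v => ?_, fun v w hvw => ?_⟩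
  · refine Finset.Icc_subset_Icc ?_ ?_ <;> fin_cases v <;> simp [s] <;> omega
  · rw [Nat.card_Icc]
    omega
  · rw [inter, Nat.card_Icc]
    by_cases h : (cycleGraph 4).Adj v w
    · rw [edist_eq_one_iff_adj.mpr h, Order.lt_one_iff]
      norm_cast
      rw [adj] at h
      fin_cases v <;> fin_cases w <;> simp [s] at h ⊢ <;> omega
    · refine lt_of_le_of_lt ?_ (one_lt_edist_of_not_adj hvw h)
      norm_cast
      rw [adj] at h
      fin_cases v <;> fin_cases w <;> simp [s] at h hvw ⊢ <;> omega

/-- `τ_t(C₄) = 4t - 2` for every positive integer `t`. -/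
theorem tone_C4 (t : ℕ) (ht : 0 < t) :
    toneChromaticNumber (cycleGraph 4) t = 4 * t - 2 := by
  have hmem : 4 * t - 2 ∈ {k | ∃ f : Fin 4 → Finset ℕ, IsTToneColoring (cycleGraph 4) t k f} :=
    exists_isTToneColoring_cycleGraph_four ht
  exact le_antisymm (Nat.sInf_le hmem)
    (le_csInf ⟨_, hmem⟩ fun _ ⟨_, hf⟩ => hf.four_mul_sub_two_le)
end
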